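/- arXiv:1503.05810 — 4 statements merged into one kernel-verified Lean document; each statement's English description precedes it below -/
import Mathlib

section
/- There is an absolute constant C with the following property. Let h > 0, let x_i = ih for i ∈ ℤ, let j ∈ ℤ, and let x* satisfy x_j ≤ x* ≤ x_{j+1}; set h₊ = x_{j+1} − x*. Let v⁻ and v⁺ be three times continuously differentiable on [x_{j−1}, x_{j+1}] with |(v⁻)'''| ≤ M and |(v⁺)'''| ≤ M there, and set [v] = v⁺(x*) − v⁻(x*), [Dv] = (v⁺)′(x*) − (v⁻)′(x*), [D²v] = (v⁺)″(x*) − (v⁻)″(x*). Then | (v⁻)′(x_j) − ( (v⁺(x_{j+1}) − v⁻(x_{j−1}))/(2h) − (1/(2h)) ( [v] + h₊ [Dv] + (h₊²/2) [D²v] ) ) | ≤ C M h². -/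
noncomputable section

/-- A function on `[a, b]` that vanishes at `x₀` and whose derivative is bounded by `K` is bounded
by `K * (b - a)`. -/
theorem abs_le_mul_length_of_hasDerivWithinAt {f f' : ℝ → ℝ} {a b K x₀ : ℝ}
    (hf : ∀ x ∈ Set.Icc a b, HasDerivWithinAt f (f' x) (Set.Icc a b) x)
    (hK : ∀ x ∈ Set.Icc a b, |f' x| ≤ K) (hx₀ : x₀ ∈ Set.Icc a b) (h₀ : f x₀ = 0) :
    ∀ x ∈ Set.Icc a b, |f x| ≤ K * (b - a) := by
  intro x hx
  have hmv := (convex_Icc a b).norm_image_sub_le_of_norm_hasDerivWithin_le hf hK hx₀ hx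
  rw [h₀, sub_zero, Real.norm_eq_abs, Real.norm_eq_abs] at hmv
  have hlen : |x - x₀| ≤ b - a :=
    abs_le.mpr ⟨by linarith [hx.1, hx₀.2], by linarith [hx.2, hx₀.1]⟩
  exact hmv.trans (mul_le_mul_of_nonneg_left hlen ((abs_nonneg _).trans (hK x hx)))

/-- Second-order Taylor expansion on `[a, b]` around any point of the interval, with a remainder
bound in terms of the length of the interval. -/
theorem abs_taylor_two_remainder_le {f f' f'' f''' : ℝ → ℝ} {a b M x₀ : ℝ}
    (hf : ∀ x ∈ Set.Icc a b, HasDerivWithinAt f (f' x) (Set.Icc a b) x)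
    (hf' : ∀ x ∈ Set.Icc a b, HasDerivWithinAt f' (f'' x) (Set.Icc a b) x)
    (hf'' : ∀ x ∈ Set.Icc a b, HasDerivWithinAt f'' (f''' x) (Set.Icc a b) x)
    (hM : ∀ x ∈ Set.Icc a b, |f''' x| ≤ M) (hx₀ : x₀ ∈ Set.Icc a b) :
    ∀ x ∈ Set.Icc a b,
      |f x - f x₀ - (x - x₀) * f' x₀ - (x - x₀) ^ 2 / 2 * f'' x₀| ≤ M * (b - a) ^ 3 := by
  have h₂ : ∀ x ∈ Set.Icc a b, |f'' x - f'' x₀| ≤ M * (b - a) :=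
    abs_le_mul_length_of_hasDerivWithinAt (f := fun x => f'' x - f'' x₀)
      (fun x hx => (hf'' x hx).sub_const _) hM hx₀ (sub_self _)
  have h₁ : ∀ x ∈ Set.Icc a b,
      |f' x - f' x₀ - (x - x₀) * f'' x₀| ≤ M * (b - a) * (b - a) := by
    refine abs_le_mul_length_of_hasDerivWithinAt
      (f := fun x => f' x - f' x₀ - (x - x₀) * f'' x₀) (fun x hx => ?_) h₂ hx₀ (by ring)
    have hlin := ((hasDerivWithinAt_id x (Set.Icc a b)).sub_const x₀).mul_const (f'' x₀)
    exact (((hf' x hx).sub_const (f' x₀)).sub hlin).congr_deriv (by ring)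
  have h₀ : ∀ x ∈ Set.Icc a b,
      |f x - f x₀ - (x - x₀) * f' x₀ - (x - x₀) ^ 2 / 2 * f'' x₀|
        ≤ M * (b - a) * (b - a) * (b - a) := by
    refine abs_le_mul_length_of_hasDerivWithinAt
      (f := fun x => f x - f x₀ - (x - x₀) * f' x₀ - (x - x₀) ^ 2 / 2 * f'' x₀)
      (fun x hx => ?_) h₁ hx₀ (by ring)
    have hid := (hasDerivWithinAt_id x (Set.Icc a b)).sub_const x₀
    have hquad := ((hid.pow 2).div_const 2).mul_const (f'' x₀)
    exact ((((hf x hx).sub_const (f x₀)).sub (hid.mul_const (f' x₀))).sub hquad).congr_deriv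
      (by simp)
  intro x hx
  exact (h₀ x hx).trans_eq (by ring)

/-- The immersed interface method correction of the one-dimensional
centered first difference: if x* ∈ [x_j, x_{j+1}] and v⁻, v⁺ are C³ on [x_{j−1}, x_{j+1}]
with third derivatives bounded by M, then the corrected centered difference approximates
(v⁻)′(x_j) with error at most C M h². Here a = x_{j−1}, b = x_{j+1}, h₊ = b − x*, and the
derivatives of v⁻, v⁺ are given by the functions vm′, vm″, vm‴ and vp′, vp″, vp‴. -/
theorem stmt13 :
    ∃ C : ℝ, ∀ h : ℝ, 0 < h → ∀ (j : ℤ) (xs M a b : ℝ)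
      (vm vp vm' vp' vm'' vp'' vm''' vp''' : ℝ → ℝ),
      a = ((j : ℝ) - 1) * h → b = ((j : ℝ) + 1) * h →
      (j : ℝ) * h ≤ xs → xs ≤ b →
      (∀ x ∈ Set.Icc a b, HasDerivWithinAt vm (vm' x) (Set.Icc a b) x) →
      (∀ x ∈ Set.Icc a b, HasDerivWithinAt vm' (vm'' x) (Set.Icc a b) x) →
      (∀ x ∈ Set.Icc a b, HasDerivWithinAt vm'' (vm''' x) (Set.Icc a b) x) →
      (∀ x ∈ Set.Icc a b, HasDerivWithinAt vp (vp' x) (Set.Icc a b) x) →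
      (∀ x ∈ Set.Icc a b, HasDerivWithinAt vp' (vp'' x) (Set.Icc a b) x) →
      (∀ x ∈ Set.Icc a b, HasDerivWithinAt vp'' (vp''' x) (Set.Icc a b) x) →
      ContinuousOn vm''' (Set.Icc a b) → ContinuousOn vp''' (Set.Icc a b) →
      (∀ x ∈ Set.Icc a b, |vm''' x| ≤ M) → (∀ x ∈ Set.Icc a b, |vp''' x| ≤ M) →
      |vm' ((j : ℝ) * h) -
        ((vp b - vm a) / (2 * h) -
          (1 / (2 * h)) * ((vp xs - vm xs) + (b - xs) * (vp' xs - vm' xs) +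
            ((b - xs) ^ 2 / 2) * (vp'' xs - vm'' xs)))|
        ≤ C * M * h ^ 2 := by
  refine ⟨16, ?_⟩
  intro h hh j xs M a b vm vp vm' vp' vm'' vp'' vm''' vp''' ha hb hjx hxb
    hm hm' hm'' hp hp' hp'' _ _ hmM hpM
  have hxs : xs ∈ Set.Icc a b := ⟨by linarith, hxb⟩
  have hj : (j : ℝ) * h ∈ Set.Icc a b := ⟨by linarith, by linarith⟩
  have haI : a ∈ Set.Icc a b := ⟨le_rfl, by linarith⟩
  have hbI : b ∈ Set.Icc a b := ⟨by linarith, le_rfl⟩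
  have hp_xs := abs_taylor_two_remainder_le hp hp' hp'' hpM hxs b hbI
  have hm_xs := abs_taylor_two_remainder_le hm hm' hm'' hmM hxs b hbI
  have hm_b := abs_taylor_two_remainder_le hm hm' hm'' hmM hj b hbI
  have hm_a := abs_taylor_two_remainder_le hm hm' hm'' hmM hj a haI
  rw [show b - a = 2 * h by linarith] at hp_xs hm_xs hm_b hm_a
  rw [show b - (j : ℝ) * h = h by linarith] at hm_b
  rw [show a - (j : ℝ) * h = -h by linarith] at hm_a
  rw [abs_le] at hp_xs hm_xs hm_b hm_a
  set E := vm' ((j : ℝ) * h) -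
    ((vp b - vm a) / (2 * h) -
      (1 / (2 * h)) * ((vp xs - vm xs) + (b - xs) * (vp' xs - vm' xs) +
        ((b - xs) ^ 2 / 2) * (vp'' xs - vm'' xs))) with hE
  have hmul : E * (2 * h) = 2 * h * vm' ((j : ℝ) * h) - (vp b - vm a) +
      ((vp xs - vm xs) + (b - xs) * (vp' xs - vm' xs) +
        ((b - xs) ^ 2 / 2) * (vp'' xs - vm'' xs)) := by
    rw [hE]
    field_simp
    ring
  have h2h : 0 < 2 * h := by linarith
  rw [abs_le]
  constructor
  · refine le_of_mul_le_mul_right ?_ h2h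
    rw [hmul]
    linarith
  · refine le_of_mul_le_mul_right ?_ h2h
    rw [hmul]
    linarith
end
end

section
/- There is an absolute constant C with the following property. Let h > 0, let x_i = ih for i ∈ ℤ, let j ∈ ℤ, and let x* satisfy x_j ≤ x* ≤ x_{j+1}; set h₊ = x_{j+1} − x*. Let v⁻ and v⁺ be three times continuously differentiable on [x_{j−1}, x_{j+1}] with |(v⁻)'''| ≤ M and |(v⁺)'''| ≤ M there, and set [v] = v⁺(x*) − v⁻(x*), [Dv] = (v⁺)′(x*) − (v⁻)′(x*), [D²v] = (v⁺)″(x*) − (v⁻)″(x*). Then | (v⁻)″(x_j) − ( (v⁻(x_{j−1}) − 2 v⁻(x_j) + v⁺(x_{j+1}))/h² − (1/h²) ( [v] + h₊ [Dv] + (h₊²/2) [D²v] ) ) | ≤ C M h. -/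
noncomputable section

/-- Second-order Taylor expansion within a closed interval, between two arbitrary points of it, with
a (non-sharp) cubic remainder bound. -/
theorem abs_sub_taylor_two_le {f f' f'' f''' : ℝ → ℝ} {a b M c x : ℝ}
    (hf : ∀ t ∈ Set.Icc a b, HasDerivWithinAt f (f' t) (Set.Icc a b) t)
    (hf' : ∀ t ∈ Set.Icc a b, HasDerivWithinAt f' (f'' t) (Set.Icc a b) t)
    (hf'' : ∀ t ∈ Set.Icc a b, HasDerivWithinAt f'' (f''' t) (Set.Icc a b) t)
    (hM : ∀ t ∈ Set.Icc a b, |f''' t| ≤ M) (hc : c ∈ Set.Icc a b) (hx : x ∈ Set.Icc a b) :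
    |f x - (f c + (x - c) * f' c + (x - c) ^ 2 / 2 * f'' c)| ≤ M / 2 * |x - c| ^ 3 := by
  have hsub : Set.uIcc c x ⊆ Set.Icc a b := Set.uIcc_subset_Icc hc hx
  have hderiv : ∀ t ∈ Set.uIcc c x,
      HasDerivWithinAt (fun t => f t + (x - t) * f' t + (x - t) ^ 2 / 2 * f'' t)
        ((x - t) ^ 2 / 2 * f''' t) (Set.uIcc c x) t := by
    intro t ht
    have h0 := (hf t (hsub ht)).mono hsub
    have h1 := (hf' t (hsub ht)).mono hsub
    have h2 := (hf'' t (hsub ht)).mono hsub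
    have hl : HasDerivWithinAt (fun t => x - t) (-1) (Set.uIcc c x) t :=
      (hasDerivWithinAt_id t _).const_sub x
    have := (h0.add (hl.mul h1)).add (((hl.pow 2).div_const 2).mul h2)
    refine this.congr_deriv ?_
    simp only [Pi.pow_apply]
    push_cast
    ring
  have hbound : ∀ t ∈ Set.uIcc c x, ‖(x - t) ^ 2 / 2 * f''' t‖ ≤ |x - c| ^ 2 / 2 * M := by
    intro t ht
    have hxt : |x - t| ≤ |x - c| := Set.abs_sub_right_of_mem_uIcc ht
    rw [Real.norm_eq_abs, abs_mul, abs_div, abs_pow, abs_two]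
    have := hM t (hsub ht)
    gcongr
  have key := (convex_uIcc c x).norm_image_sub_le_of_norm_hasDerivWithin_le hderiv hbound
    Set.left_mem_uIcc Set.right_mem_uIcc
  simp only [Real.norm_eq_abs, sub_self, zero_mul, ne_eq, OfNat.ofNat_ne_zero, not_false_eq_true,
    zero_pow, zero_div, add_zero] at key
  exact key.trans_eq (by ring)

/-- The immersed interface method correction of the one-dimensional
centered second difference: if x* ∈ [x_j, x_{j+1}] and v⁻, v⁺ are C³ on [x_{j−1}, x_{j+1}]
with third derivatives bounded by M, then the corrected centered second difference
approximates (v⁻)″(x_j) with error at most C M h. Here a = x_{j−1}, b = x_{j+1},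
h₊ = b − x*, and the derivatives of v⁻, v⁺ are the functions vm′, vm″, vm‴, vp′, vp″, vp‴. -/
theorem stmt14 :
    ∃ C : ℝ, ∀ h : ℝ, 0 < h → ∀ (j : ℤ) (xs M a b : ℝ)
      (vm vp vm' vp' vm'' vp'' vm''' vp''' : ℝ → ℝ),
      a = ((j : ℝ) - 1) * h → b = ((j : ℝ) + 1) * h →
      (j : ℝ) * h ≤ xs → xs ≤ b →
      (∀ x ∈ Set.Icc a b, HasDerivWithinAt vm (vm' x) (Set.Icc a b) x) →
      (∀ x ∈ Set.Icc a b, HasDerivWithinAt vm' (vm'' x) (Set.Icc a b) x) →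
      (∀ x ∈ Set.Icc a b, HasDerivWithinAt vm'' (vm''' x) (Set.Icc a b) x) →
      (∀ x ∈ Set.Icc a b, HasDerivWithinAt vp (vp' x) (Set.Icc a b) x) →
      (∀ x ∈ Set.Icc a b, HasDerivWithinAt vp' (vp'' x) (Set.Icc a b) x) →
      (∀ x ∈ Set.Icc a b, HasDerivWithinAt vp'' (vp''' x) (Set.Icc a b) x) →
      ContinuousOn vm''' (Set.Icc a b) → ContinuousOn vp''' (Set.Icc a b) →
      (∀ x ∈ Set.Icc a b, |vm''' x| ≤ M) → (∀ x ∈ Set.Icc a b, |vp''' x| ≤ M) →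
      |vm'' ((j : ℝ) * h) -
        ((vm a - 2 * vm ((j : ℝ) * h) + vp b) / h ^ 2 -
          (1 / h ^ 2) * ((vp xs - vm xs) + (b - xs) * (vp' xs - vm' xs) +
            ((b - xs) ^ 2 / 2) * (vp'' xs - vm'' xs)))|
        ≤ C * M * h := by
  refine ⟨2, ?_⟩
  intro h hh j xs M a b vm vp vm' vp' vm'' vp'' vm''' vp''' ha hb hjx hxb
    hm hm' hm'' hp hp' hp'' _ _ hmM hpM
  set y : ℝ := (j : ℝ) * h
  have hay : a = y - h := by rw [ha]; ring
  have hby : b = y + h := by rw [hb]; ring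
  have hya : a ∈ Set.Icc a b := ⟨le_rfl, by linarith⟩
  have hyb : b ∈ Set.Icc a b := ⟨by linarith, le_rfl⟩
  have hyy : y ∈ Set.Icc a b := ⟨by linarith, by linarith⟩
  have hyx : xs ∈ Set.Icc a b := ⟨by linarith, hxb⟩
  have hM : 0 ≤ M := (abs_nonneg _).trans (hmM a hya)
  have remainder_le {d R : ℝ} (hd : |d| ≤ h) (hR : |R| ≤ M / 2 * |d| ^ 3) :
      |R| ≤ M / 2 * h ^ 3 := hR.trans (by gcongr)
  have hxs : |b - xs| ≤ h := abs_le.2 ⟨by linarith, by linarith⟩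
  have r1 := abs_le.1 <| remainder_le (abs_le.2 ⟨by linarith, by linarith⟩)
    (abs_sub_taylor_two_le hm hm' hm'' hmM hyy hya)
  have r2 := abs_le.1 <| remainder_le (abs_le.2 ⟨by linarith, by linarith⟩)
    (abs_sub_taylor_two_le hm hm' hm'' hmM hyy hyb)
  have r3 := abs_le.1 <| remainder_le hxs (abs_sub_taylor_two_le hm hm' hm'' hmM hyx hyb)
  have r4 := abs_le.1 <| remainder_le hxs (abs_sub_taylor_two_le hp hp' hp'' hpM hyx hyb)
  rw [show a - y = -h by linarith] at r1
  rw [show b - y = h by linarith] at r2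
  have hnum : |h ^ 2 * vm'' y - ((vm a - 2 * vm y + vp b) -
      ((vp xs - vm xs) + (b - xs) * (vp' xs - vm' xs) +
        ((b - xs) ^ 2 / 2) * (vp'' xs - vm'' xs)))| ≤ 2 * M * h ^ 3 :=
    abs_le.2 ⟨by linarith, by linarith⟩
  have hh2 : 0 < h ^ 2 := by positivity
  calc _ = |(h ^ 2 * vm'' y - ((vm a - 2 * vm y + vp b) -
      ((vp xs - vm xs) + (b - xs) * (vp' xs - vm' xs) +
        ((b - xs) ^ 2 / 2) * (vp'' xs - vm'' xs)))) / h ^ 2| := by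
        congr 1
        field_simp
    _ ≤ 2 * M * h := by
        rw [abs_div, abs_of_pos hh2, div_le_iff₀ hh2]
        exact hnum.trans_eq (by ring)
end
end

section
/- Let σ(ξ) = (sin⁴(ξ₁/2) + sin⁴(ξ₂/2)) / (sin²(ξ₁/2) + sin²(ξ₂/2)) for ξ ∈ [−π,π]² with (sin²(ξ₁/2) + sin²(ξ₂/2)) ≠ 0, and set σ(ξ) = 0 where sin²(ξ₁/2) + sin²(ξ₂/2) = 0. There is a constant C such that for all ξ ∈ [−π,π]²: 0 ≤ σ(ξ) ≤ C min(1, |ξ|²), and at every ξ ∈ [−π,π]² with ξ ≠ 0 the partial derivatives satisfy |∂σ/∂ξ₁(ξ)| ≤ C and |∂σ/∂ξ₂(ξ)| ≤ C. -/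
noncomputable section

/-- The Fourier symbol of A = (Δ_h − Δ_0)Δ_h⁻¹ in dimension 2:
σ(ξ) = (sin⁴(ξ₁/2) + sin⁴(ξ₂/2)) / (sin²(ξ₁/2) + sin²(ξ₂/2)), set to 0 where the
denominator vanishes. -/
def sig (ξ : ℝ × ℝ) : ℝ :=
  if Real.sin (ξ.1 / 2) ^ 2 + Real.sin (ξ.2 / 2) ^ 2 = 0 then 0
  else (Real.sin (ξ.1 / 2) ^ 4 + Real.sin (ξ.2 / 2) ^ 4) /
    (Real.sin (ξ.1 / 2) ^ 2 + Real.sin (ξ.2 / 2) ^ 2)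

theorem sig_eq_div (x y : ℝ) :
    sig (x, y) = (Real.sin (x / 2) ^ 4 + Real.sin (y / 2) ^ 4) /
      (Real.sin (x / 2) ^ 2 + Real.sin (y / 2) ^ 2) := by
  unfold sig
  split_ifs with h
  · simp only at h
    rw [h, div_zero]
  · rfl

theorem sig_swap (x y : ℝ) : sig (x, y) = sig (y, x) := by
  rw [sig_eq_div, sig_eq_div, add_comm, add_comm (Real.sin (x / 2) ^ 2)]

theorem sig_nonneg (x y : ℝ) : 0 ≤ sig (x, y) := by
  rw [sig_eq_div]
  positivity

theorem sig_le_one (x y : ℝ) : sig (x, y) ≤ 1 := by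
  rw [sig_eq_div]
  refine div_le_one_of_le₀ ?_ (by positivity)
  have h (z : ℝ) : Real.sin z ^ 4 ≤ Real.sin z ^ 2 := by
    nlinarith [Real.sin_sq_le_one z, sq_nonneg (Real.sin z)]
  linarith [h (x / 2), h (y / 2)]

theorem sig_le_sq_add_sq (x y : ℝ) : sig (x, y) ≤ x ^ 2 + y ^ 2 := by
  have h (z : ℝ) : Real.sin (z / 2) ^ 2 ≤ z ^ 2 := by
    have := sq_le_sq.mpr (Real.abs_sin_le_abs (x := z / 2))
    nlinarith [sq_nonneg z]
  calc sig (x, y) ≤ Real.sin (x / 2) ^ 2 + Real.sin (y / 2) ^ 2 := by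
        rw [sig_eq_div]
        refine div_le_of_le_mul₀ (by positivity) (by positivity) ?_
        nlinarith [mul_nonneg (sq_nonneg (Real.sin (x / 2))) (sq_nonneg (Real.sin (y / 2)))]
    _ ≤ x ^ 2 + y ^ 2 := add_le_add (h x) (h y)

theorem sin_half_eq_zero {x : ℝ} (hx : x ∈ Set.Icc (-Real.pi) Real.pi)
    (h : Real.sin (x / 2) = 0) : x = 0 := by
  have := (Real.sin_eq_zero_iff_of_lt_of_lt (x := x / 2)
    (by linarith [hx.1, Real.pi_pos]) (by linarith [hx.2, Real.pi_pos])).mp h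
  linarith

theorem sin_half_sq_add_sq_pos {x y : ℝ} (hx : x ∈ Set.Icc (-Real.pi) Real.pi)
    (hy : y ∈ Set.Icc (-Real.pi) Real.pi) (h : ¬(x = 0 ∧ y = 0)) :
    0 < Real.sin (x / 2) ^ 2 + Real.sin (y / 2) ^ 2 := by
  by_contra! hle
  refine h ⟨sin_half_eq_zero hx ?_, sin_half_eq_zero hy ?_⟩ <;>
    refine (pow_eq_zero_iff two_ne_zero).mp ?_ <;>
    nlinarith [sq_nonneg (Real.sin (x / 2)), sq_nonneg (Real.sin (y / 2))]

theorem hasDerivAt_sig_fst {x y : ℝ}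
    (h : Real.sin (x / 2) ^ 2 + Real.sin (y / 2) ^ 2 ≠ 0) :
    HasDerivAt (fun t => sig (t, y))
      (Real.sin (x / 2) * Real.cos (x / 2) *
        ((Real.sin (x / 2) ^ 4 + 2 * Real.sin (x / 2) ^ 2 * Real.sin (y / 2) ^ 2
          - Real.sin (y / 2) ^ 4) / (Real.sin (x / 2) ^ 2 + Real.sin (y / 2) ^ 2) ^ 2)) x := by
  simp only [sig_eq_div]
  have hs : HasDerivAt (fun t : ℝ => Real.sin (t / 2)) (Real.cos (x / 2) * (1 / 2)) x :=
    ((hasDerivAt_id x).div_const 2).sin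
  refine (((hs.fun_pow 4).add_const (Real.sin (y / 2) ^ 4)).fun_div
    ((hs.fun_pow 2).add_const (Real.sin (y / 2) ^ 2)) h).congr_deriv ?_
  rw [← mul_div_assoc]
  push_cast
  ring

theorem abs_deriv_sig_fst_le {x y : ℝ}
    (h : 0 < Real.sin (x / 2) ^ 2 + Real.sin (y / 2) ^ 2) :
    |deriv (fun t => sig (t, y)) x| ≤ 1 := by
  rw [(hasDerivAt_sig_fst h.ne').deriv, abs_mul, abs_mul]
  refine mul_le_one₀ (mul_le_one₀ (Real.abs_sin_le_one _) (abs_nonneg _)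
    (Real.abs_cos_le_one _)) (abs_nonneg _) ?_
  rw [abs_div, abs_of_pos (pow_pos h 2)]
  refine div_le_one_of_le₀ (abs_le.mpr ⟨?_, ?_⟩) (by positivity)
  all_goals
    have h1 : 0 ≤ Real.sin (x / 2) ^ 4 := by positivity
    have h2 : 0 ≤ Real.sin (y / 2) ^ 4 := by positivity
    have h3 : 0 ≤ Real.sin (x / 2) ^ 2 * Real.sin (y / 2) ^ 2 := by positivity
    nlinarith

/-- On [−π,π]², the symbol σ satisfies 0 ≤ σ(ξ) ≤ C min(1,|ξ|²), and
its first partial derivatives are bounded by C at every ξ ≠ 0. -/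
theorem stmt16 :
    ∃ C : ℝ, ∀ ξ : ℝ × ℝ, ξ.1 ∈ Set.Icc (-Real.pi) Real.pi →
      ξ.2 ∈ Set.Icc (-Real.pi) Real.pi →
      (0 ≤ sig ξ ∧ sig ξ ≤ C * min 1 (ξ.1 ^ 2 + ξ.2 ^ 2)) ∧
      (ξ ≠ 0 →
        |deriv (fun t => sig (t, ξ.2)) ξ.1| ≤ C ∧
        |deriv (fun t => sig (ξ.1, t)) ξ.2| ≤ C) := by
  refine ⟨1, ?_⟩
  rintro ⟨x, y⟩ hx hy
  refine ⟨⟨sig_nonneg x y, ?_⟩, fun hne => ?_⟩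
  · rw [one_mul]
    exact le_min (sig_le_one x y) (sig_le_sq_add_sq x y)
  · have hpos := sin_half_sq_add_sq_pos hx hy fun h => hne (Prod.ext h.1 h.2)
    refine ⟨abs_deriv_sig_fst_le hpos, ?_⟩
    simp only [sig_swap x]
    exact abs_deriv_sig_fst_le (by rwa [add_comm])
end
end

section
/- Let σ(ξ) = (sin⁴(ξ₁/2) + sin⁴(ξ₂/2)) / (sin²(ξ₁/2) + sin²(ξ₂/2)) for ξ with sin²(ξ₁/2) + sin²(ξ₂/2) ≠ 0, extended 2π-periodically in each variable and with σ = 0 at the points of 2πℤ². Then: (i) there is a constant C such that |∂²σ/∂ξ_ν²(ξ)| ≤ C for all ξ ∈ [−π,π]² \ {0} and ν = 1,2; and (ii) there is a constant C′ such that for every positive integer N (h = π/N), every k ∈ I_2 and ν = 1,2, the second divided difference satisfies |σ((k+e_ν)h) − 2σ(kh) + σ((k−e_ν)h)| / h² ≤ C′, uniformly in h and k (including the lattice points adjacent to 0). -/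
noncomputable section

theorem sig_eq (x y : ℝ) : sig (x, y) =
    Real.sin (x / 2) ^ 2 - Real.sin (y / 2) ^ 2 +
      2 * (Real.sin (y / 2) ^ 2) ^ 2 / (Real.sin (x / 2) ^ 2 + Real.sin (y / 2) ^ 2) := by
  unfold sig
  dsimp only
  split_ifs with h
  · have hx := sq_nonneg (Real.sin (x / 2))
    have hy := sq_nonneg (Real.sin (y / 2))
    have hx0 : Real.sin (x / 2) ^ 2 = 0 := by linarith
    have hy0 : Real.sin (y / 2) ^ 2 = 0 := by linarith
    simp [hx0, hy0]
  · field_simp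
    ring

theorem hasDerivAt_sin_half (t : ℝ) :
    HasDerivAt (fun t => Real.sin (t / 2)) (Real.cos (t / 2) / 2) t := by
  simpa [div_eq_mul_inv] using ((hasDerivAt_id t).div_const 2).sin

theorem hasDerivAt_cos_half (t : ℝ) :
    HasDerivAt (fun t => Real.cos (t / 2)) (-Real.sin (t / 2) / 2) t := by
  simpa [div_eq_mul_inv] using ((hasDerivAt_id t).div_const 2).cos

theorem hasDerivAt_sin_half_sq (t : ℝ) :
    HasDerivAt (fun t => Real.sin (t / 2) ^ 2) (Real.sin (t / 2) * Real.cos (t / 2)) t := by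
  refine ((hasDerivAt_sin_half t).pow 2).congr_deriv ?_
  ring

theorem hasDerivAt_sin_half_mul_cos_half (t : ℝ) :
    HasDerivAt (fun t => Real.sin (t / 2) * Real.cos (t / 2))
      (1 / 2 - Real.sin (t / 2) ^ 2) t := by
  refine ((hasDerivAt_sin_half t).mul (hasDerivAt_cos_half t)).congr_deriv ?_
  linear_combination (1 / 2) * Real.sin_sq_add_cos_sq (t / 2)

theorem abs_second_deriv_formula_le {s b : ℝ} (hs : 0 ≤ s) (hs1 : s ≤ 1) (hb : 0 < b) :
    |(1 / 2 - s) - 2 * b ^ 2 * ((1 / 2 - s) / (s + b) ^ 2 - 2 * (s * (1 - s)) / (s + b) ^ 3)|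
      ≤ 6 := by
  have hp : 0 < s + b := by linarith
  set p := b / (s + b) with hpdef
  have hp0 : 0 ≤ p := by positivity
  have hp1 : p ≤ 1 := by rw [hpdef, div_le_one hp]; linarith
  have e : (1 / 2 - s) -
      2 * b ^ 2 * ((1 / 2 - s) / (s + b) ^ 2 - 2 * (s * (1 - s)) / (s + b) ^ 3)
      = (1 / 2 - s) * (1 - 2 * p ^ 2) + 4 * (p ^ 2 * (1 - p)) * (1 - s) := by
    rw [hpdef]
    field_simp
    ring
  have hpp : p ^ 2 ≤ 1 := pow_le_one₀ hp0 hp1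
  have h1 : |(1 / 2 - s) * (1 - 2 * p ^ 2)| ≤ 1 := by
    rw [abs_mul]
    refine mul_le_one₀ ?_ (abs_nonneg _) ?_ <;> rw [abs_le] <;> constructor <;> nlinarith
  have h2 : |4 * (p ^ 2 * (1 - p)) * (1 - s)| ≤ 4 := by
    have h3 : 0 ≤ p ^ 2 * (1 - p) := mul_nonneg (sq_nonneg p) (by linarith)
    have h4 : p ^ 2 * (1 - p) ≤ 1 := mul_le_one₀ hpp (by linarith) (by linarith)
    have h5 : p ^ 2 * (1 - p) * (1 - s) ≤ 1 := mul_le_one₀ h4 (by linarith) (by linarith)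
    have h6 : 0 ≤ p ^ 2 * (1 - p) * (1 - s) := mul_nonneg h3 (by linarith)
    rw [abs_le]
    constructor <;> linarith
  rw [e]
  linarith [abs_add_le ((1 / 2 - s) * (1 - 2 * p ^ 2)) (4 * (p ^ 2 * (1 - p)) * (1 - s))]

/-- Every horizontal slice of `sig` is twice differentiable, including slices through `2πℤ²`,
with second derivative bounded by an absolute constant. -/
theorem exists_hasDerivAt_sig_slice (y : ℝ) : ∃ f' f'' : ℝ → ℝ,
    (∀ t, HasDerivAt (fun t => sig (t, y)) (f' t) t) ∧
    (∀ t, HasDerivAt f' (f'' t) t) ∧ ∀ t, |f'' t| ≤ 6 := by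
  simp only [sig_eq]
  have hb := sq_nonneg (Real.sin (y / 2))
  generalize Real.sin (y / 2) ^ 2 = b at hb
  rcases hb.eq_or_lt with rfl | hb
  · refine ⟨_, _, fun t => ?_, hasDerivAt_sin_half_mul_cos_half, fun t => ?_⟩
    · simpa using hasDerivAt_sin_half_sq t
    · have := Real.sin_sq_le_one (t / 2)
      have := sq_nonneg (Real.sin (t / 2))
      rw [abs_le]
      constructor <;> linarith
  · have hpos (t : ℝ) : Real.sin (t / 2) ^ 2 + b ≠ 0 := by positivity
    refine ⟨fun t => Real.sin (t / 2) * Real.cos (t / 2) - 2 * b ^ 2 *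
        ((Real.sin (t / 2) * Real.cos (t / 2)) / (Real.sin (t / 2) ^ 2 + b) ^ 2),
      fun t => (1 / 2 - Real.sin (t / 2) ^ 2) - 2 * b ^ 2 *
        ((1 / 2 - Real.sin (t / 2) ^ 2) / (Real.sin (t / 2) ^ 2 + b) ^ 2 -
          2 * (Real.sin (t / 2) ^ 2 * (1 - Real.sin (t / 2) ^ 2)) /
            (Real.sin (t / 2) ^ 2 + b) ^ 3),
      fun t => ?_, fun t => ?_, fun t => ?_⟩
    · have hs := hasDerivAt_sin_half_sq t
      refine ((hs.sub_const b).add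
        ((hasDerivAt_const t (2 * b ^ 2)).div (hs.add_const b) (hpos t))).congr_deriv ?_
      ring
    · have hd := ((hasDerivAt_sin_half_sq t).add_const b).pow 2
      have hm := hasDerivAt_sin_half_mul_cos_half t
      refine (hm.sub
        ((hm.div hd (pow_ne_zero 2 (hpos t))).const_mul (2 * b ^ 2))).congr_deriv ?_
      have := hpos t
      simp only [Pi.pow_apply, ← Real.cos_sq']
      field_simp
      ring
    · exact abs_second_deriv_formula_le (sq_nonneg _) (Real.sin_sq_le_one _) hb

theorem abs_second_difference_le {f f' f'' : ℝ → ℝ} {M : ℝ} (hf : ∀ t, HasDerivAt f (f' t) t)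
    (hf' : ∀ t, HasDerivAt f' (f'' t) t) (hM : ∀ t, |f'' t| ≤ M) (x : ℝ) {h : ℝ} (hh : 0 ≤ h) :
    |f (x + h) - 2 * f x + f (x - h)| ≤ 2 * M * h ^ 2 := by
  have hM0 : 0 ≤ M := (abs_nonneg _).trans (hM x)
  have hlip (a b : ℝ) : |f' b - f' a| ≤ M * |b - a| :=
    convex_univ.norm_image_sub_le_of_norm_hasDerivWithin_le
      (fun t _ => (hf' t).hasDerivWithinAt) (fun t _ => hM t) (Set.mem_univ a) (Set.mem_univ b)
  have hd (u : ℝ) :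
      HasDerivAt (fun u => f (x + u) + f (x - u)) (f' (x + u) - f' (x - u)) u := by
    exact (((hf (x + u)).comp_const_add x u).add
      ((hf (x - u)).comp_const_sub x u)).congr_deriv (sub_eq_add_neg _ _).symm
  have key := (convex_Icc 0 h).norm_image_sub_le_of_norm_hasDerivWithin_le (C := 2 * M * h)
    (fun u _ => (hd u).hasDerivWithinAt)
    (fun u hu => by
      refine (hlip (x - u) (x + u)).trans ?_
      rw [show x + u - (x - u) = 2 * u by ring, abs_of_nonneg (by linarith [hu.1])]
      nlinarith [mul_le_mul_of_nonneg_left hu.2 hM0])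
    (Set.left_mem_Icc.2 hh) (Set.right_mem_Icc.2 hh)
  simp only [Real.norm_eq_abs, add_zero, sub_zero, abs_of_nonneg hh] at key
  calc _ = |f (x + h) + f (x - h) - (f x + f x)| := by congr 1; ring
    _ ≤ _ := key
    _ = _ := by ring

theorem abs_deriv_deriv_sig_le (x y : ℝ) : |deriv (deriv (fun t => sig (t, y))) x| ≤ 6 := by
  obtain ⟨f', f'', hf, hf', hM⟩ := exists_hasDerivAt_sig_slice y
  rw [deriv_eq hf, (hf' x).deriv]
  exact hM x

theorem abs_divided_difference_sig_le (a y : ℝ) {h : ℝ} (hh : 0 < h) :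
    |sig ((a + 1) * h, y) - 2 * sig (a * h, y) + sig ((a - 1) * h, y)| / h ^ 2 ≤ 12 := by
  obtain ⟨f', f'', hf, hf', hM⟩ := exists_hasDerivAt_sig_slice y
  rw [div_le_iff₀ (by positivity), add_mul, sub_mul, one_mul]
  exact (abs_second_difference_le hf hf' hM (a * h) hh.le).trans_eq (by ring)

/-- (i) The second partial derivatives of σ are bounded on
[−π,π]² \ {0}; (ii) the second divided differences of σ on the grid (π/N)ℤ² are bounded
uniformly in N and in k ∈ I_2, including at lattice points adjacent to the origin. -/
theorem stmt17 :
    (∃ C : ℝ, ∀ ξ : ℝ × ℝ, ξ.1 ∈ Set.Icc (-Real.pi) Real.pi →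
      ξ.2 ∈ Set.Icc (-Real.pi) Real.pi → ξ ≠ 0 →
      |deriv (deriv (fun t => sig (t, ξ.2))) ξ.1| ≤ C ∧
      |deriv (deriv (fun t => sig (ξ.1, t))) ξ.2| ≤ C) ∧
    (∃ C' : ℝ, ∀ N : ℕ, 0 < N → ∀ k : ℤ × ℤ,
      -(N : ℤ) < k.1 → k.1 ≤ (N : ℤ) → -(N : ℤ) < k.2 → k.2 ≤ (N : ℤ) →
      |sig (((k.1 : ℝ) + 1) * (Real.pi / N), (k.2 : ℝ) * (Real.pi / N))
          - 2 * sig ((k.1 : ℝ) * (Real.pi / N), (k.2 : ℝ) * (Real.pi / N))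
          + sig (((k.1 : ℝ) - 1) * (Real.pi / N), (k.2 : ℝ) * (Real.pi / N))|
        / (Real.pi / N) ^ 2 ≤ C' ∧
      |sig ((k.1 : ℝ) * (Real.pi / N), ((k.2 : ℝ) + 1) * (Real.pi / N))
          - 2 * sig ((k.1 : ℝ) * (Real.pi / N), (k.2 : ℝ) * (Real.pi / N))
          + sig ((k.1 : ℝ) * (Real.pi / N), ((k.2 : ℝ) - 1) * (Real.pi / N))|
        / (Real.pi / N) ^ 2 ≤ C') := by
  refine ⟨⟨6, fun ξ _ _ _ => ⟨abs_deriv_deriv_sig_le _ _, ?_⟩⟩,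
    ⟨12, fun N hN k _ _ _ _ => ?_⟩⟩
  · simp only [sig_swap ξ.1]
    exact abs_deriv_deriv_sig_le _ _
  · have hh : 0 < Real.pi / N := div_pos Real.pi_pos (Nat.cast_pos.2 hN)
    refine ⟨abs_divided_difference_sig_le _ _ hh, ?_⟩
    simp only [sig_swap ((k.1 : ℝ) * (Real.pi / N))]
    exact abs_divided_difference_sig_le _ _ hh
end
end
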